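/- Expansion theorem: let f(q) = ∑ₙ qⁿ aₙ have radius of convergence R > 0 and let p ∈ H with |p| < R. Then for all q with σ(q,p) < R - |p|, f(q) = ∑ₙ (q-p)^{*n} f^{(n)}(p)/n!, where f^{(n)}(p) = ∑ₘ pᵐ a_{m+n}(m+n)!/m! and (q-p)^{*n} is the n-th regular power. -/

import Mathlib

local notation "ℍ" => Quaternion ℝ

/-- Convolution (star) product of coefficient sequences. -/
noncomputable def conv (a b : ℕ → ℍ) : ℕ → ℍ := fun n => ∑ k ∈ Finset.range (n+1), a k * b (n-k)

/-- Coefficient sequence of the polynomial `q - p` (right coefficients). -/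
noncomputable def binomSeq (p : ℍ) : ℕ → ℍ := fun k => if k = 0 then -p else if k = 1 then 1 else 0

/-- n-fold star (convolution) power of a coefficient sequence. -/
noncomputable def convPow (a : ℕ → ℍ) : ℕ → ℕ → ℍ
  | 0 => fun k => if k = 0 then 1 else 0
  | n+1 => conv (convPow a n) a

/-- The regular power `(q-p)^{*n}` evaluated at `q`. -/
noncomputable def starPow (p : ℍ) (n : ℕ) (q : ℍ) : ℍ :=
  ∑ k ∈ Finset.range (n+1), q^k * convPow (binomSeq p) n k

noncomputable def omegaDist (q p : ℍ) : ℝ :=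
  Real.sqrt ((q.re - p.re)^2 + (‖q.im‖ + ‖p.im‖)^2)

/-- `q` and `p` lie in a common complex line `L_I = ℝ + Iℝ`. -/
def SameLine (q p : ℍ) : Prop :=
  ∃ I : ℍ, I^2 = -1 ∧ (∃ a b : ℝ, q = (a : ℍ) + b • I) ∧ (∃ a b : ℝ, p = (a : ℍ) + b • I)

open Classical in
noncomputable def sigmaDist (q p : ℍ) : ℝ :=
  if SameLine q p then ‖q - p‖ else omegaDist q p

theorem conv_binomSeq_zero (b : ℕ → ℍ) (p : ℍ) : conv b (binomSeq p) 0 = b 0 * -p := by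
  simp [conv, binomSeq]

theorem conv_binomSeq_succ (b : ℕ → ℍ) (p : ℍ) (k : ℕ) :
    conv b (binomSeq p) (k + 1) = b (k + 1) * -p + b k := by
  have hzero : ∑ j ∈ Finset.range k, b j * binomSeq p (k + 1 - j) = 0 := by
    refine Finset.sum_eq_zero fun j hj => ?_
    have hj' := Finset.mem_range.mp hj
    have h0 : k + 1 - j ≠ 0 := by omega
    have h1 : k + 1 - j ≠ 1 := by omega
    simp [binomSeq, h0, h1]
  rw [conv, Finset.sum_range_succ, Finset.sum_range_succ, hzero]
  simp [binomSeq, add_comm]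

theorem convPow_binomSeq_eq_zero (p : ℍ) {n k : ℕ} (h : n < k) :
    convPow (binomSeq p) n k = 0 := by
  induction n generalizing k with
  | zero => simp [convPow, Nat.ne_of_gt h]
  | succ n ih =>
    obtain ⟨k, rfl⟩ : ∃ j, k = j + 1 := ⟨k - 1, by omega⟩
    rw [convPow, conv_binomSeq_succ, ih (by omega), ih (by omega)]
    simp

theorem starPow_zero (p q : ℍ) : starPow p 0 q = 1 := by
  simp [starPow, convPow]

theorem starPow_succ (p : ℍ) (n : ℕ) (q : ℍ) :
    starPow p (n + 1) q = q * starPow p n q - starPow p n q * p := by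
  have hlast : starPow p n q =
      ∑ k ∈ Finset.range (n + 2), q ^ k * convPow (binomSeq p) n k := by
    rw [Finset.sum_range_succ, convPow_binomSeq_eq_zero p n.lt_succ_self, mul_zero, add_zero,
      starPow]
  have hright : starPow p n q * p =
      ∑ k ∈ Finset.range (n + 1), q ^ (k + 1) * convPow (binomSeq p) n (k + 1) * p +
        convPow (binomSeq p) n 0 * p := by
    rw [hlast, Finset.sum_range_succ', add_mul, Finset.sum_mul, pow_zero, one_mul]
  rw [hright, starPow, Finset.sum_range_succ']
  simp only [convPow, conv_binomSeq_succ, conv_binomSeq_zero, starPow, Finset.mul_sum, mul_add,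
    Finset.sum_add_distrib, pow_succ', mul_assoc, mul_neg, Finset.sum_neg_distrib, pow_zero,
    one_mul]
  abel

/-- The binomial expansion of `q ^ k` in regular powers of `q - p`. -/
theorem pow_eq_sum_starPow (p q : ℍ) (k : ℕ) :
    q ^ k = ∑ x ∈ Finset.HasAntidiagonal.antidiagonal k,
      starPow p x.1 q * (k.choose x.1 • p ^ x.2) := by
  set L : Module.End ℝ ℍ := LinearMap.mulLeft ℝ q with hL
  set T : Module.End ℝ ℍ := LinearMap.mulRight ℝ p with hT
  have hLT : Commute L T := LinearMap.commute_mulLeft_right q p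
  have hpow : ∀ n, ((L - T) ^ n) 1 = starPow p n q := by
    intro n
    induction n with
    | zero => simp [starPow_zero]
    | succ n ih => rw [pow_succ', Module.End.mul_apply, ih, starPow_succ]; simp [hL, hT]
  have hcomm : Commute T (L - T) := hLT.symm.sub_right (Commute.refl T)
  have hexp := congrArg (fun A : Module.End ℝ ℍ => A 1) (hcomm.symm.add_pow' k)
  simp only [sub_add_cancel] at hexp
  rw [hL, LinearMap.pow_mulLeft, LinearMap.mulLeft_apply, mul_one, LinearMap.sum_apply] at hexp
  rw [hexp]
  refine Finset.sum_congr rfl fun x _ => ?_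
  rw [← hL, (hcomm.symm.pow_pow x.1 x.2).eq, LinearMap.smul_apply, Module.End.mul_apply, hpow, hT,
    LinearMap.pow_mulRight, LinearMap.mulRight_apply, mul_smul_comm]

theorem starPow_of_commute {p q : ℍ} (h : Commute q p) (n : ℕ) : starPow p n q = (q - p) ^ n := by
  induction n with
  | zero => simp [starPow_zero]
  | succ n ih =>
    have hp : Commute ((q - p) ^ n) p := (h.sub_left (Commute.refl p)).pow_left n
    rw [starPow_succ, ih, hp.eq, ← sub_mul, pow_succ']

theorem SameLine.commute {p q : ℍ} (h : SameLine q p) : Commute q p := by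
  obtain ⟨I, -, ⟨x, y, rfl⟩, ⟨u, v, rfl⟩⟩ := h
  have hI : Commute ((x : ℍ) + y • I) I :=
    (Quaternion.coe_commute x I).add_left ((Commute.refl I).smul_left y)
  exact (Quaternion.coe_commute u _).symm.add_right (hI.smul_right v)

theorem exists_imaginary_unit (q : ℍ) :
    ∃ I : ℍ, I * I = -1 ∧ I.re = 0 ∧ ‖I‖ = 1 ∧ q = (q.re : ℍ) + ‖q.im‖ • I := by
  have hunit : ∀ I : ℍ, I.re = 0 → ‖I‖ = 1 → I * I = -1 := by
    intro I hre hnorm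
    have hstar : star I = -I := Quaternion.star_eq_neg.mpr hre
    have h := Quaternion.self_mul_star I
    rw [hstar, Quaternion.normSq_eq_norm_mul_self, hnorm] at h
    simpa [neg_eq_iff_eq_neg] using h
  by_cases h : q.im = 0
  · obtain ⟨I, hre, hnorm⟩ : ∃ I : ℍ, I.re = 0 ∧ ‖I‖ = 1 := by
      obtain ⟨I, h0, h1, h2, h3⟩ : ∃ I : ℍ, I.re = 0 ∧ I.imI = 1 ∧ I.imJ = 0 ∧ I.imK = 0 :=
        ⟨⟨0, 1, 0, 0⟩, rfl, rfl, rfl, rfl⟩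
      have hsq := Quaternion.normSq_eq_norm_mul_self I
      rw [Quaternion.normSq_def', h0, h1, h2, h3] at hsq
      exact ⟨I, h0, by nlinarith [norm_nonneg I]⟩
    refine ⟨I, hunit I hre hnorm, hre, hnorm, ?_⟩
    rw [h, norm_zero, zero_smul]
    simpa [h] using (Quaternion.re_add_im q).symm
  · have hn : ‖q.im‖ ≠ 0 := norm_ne_zero_iff.mpr h
    have hre : (‖q.im‖⁻¹ • q.im).re = 0 := by simp
    have hnorm : ‖(‖q.im‖⁻¹ • q.im)‖ = 1 := by
      rw [norm_smul, norm_inv, norm_norm, inv_mul_cancel₀ hn]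
    refine ⟨‖q.im‖⁻¹ • q.im, hunit _ hre hnorm, hre, hnorm, ?_⟩
    rw [smul_inv_smul₀ hn, Quaternion.re_add_im]

theorem quaternion_norm_natCast (n : ℕ) : ‖(n : ℍ)‖ = n := by
  rw [← Quaternion.coe_natCast, Quaternion.norm_coe, Real.norm_natCast]

theorem norm_coe_add_smul_of_unit {J : ℍ} (hre : J.re = 0) (hnorm : ‖J‖ = 1) (s t : ℝ) :
    ‖(s : ℍ) + t • J‖ = √(s ^ 2 + t ^ 2) := by
  have hJ : J.imI ^ 2 + J.imJ ^ 2 + J.imK ^ 2 = 1 := by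
    have h := Quaternion.normSq_eq_norm_mul_self J
    rw [Quaternion.normSq_def', hnorm, hre] at h
    linarith
  rw [← Real.sqrt_mul_self (norm_nonneg _), ← Quaternion.normSq_eq_norm_mul_self,
    Quaternion.normSq_def']
  congr 1
  simp [hre]
  linear_combination t ^ 2 * hJ

/-- If `q * c = c * z` and `q * d = d * w` with `c + d = 1`, then `q ^ k = c * z ^ k + d * w ^ k`, so
the regular powers of `q - p` are controlled by those of `z - p` and `w - p`. -/
theorem norm_starPow_le_of_semiconj {p q z w c d : ℍ} {r : ℝ} (hcd : c + d = 1)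
    (hc : q * c = c * z) (hd : q * d = d * w) (hz : Commute z p) (hw : Commute w p)
    (hcn : ‖c‖ ≤ 1) (hdn : ‖d‖ ≤ 1) (hzr : ‖z - p‖ ≤ r) (hwr : ‖w - p‖ ≤ r) (n : ℕ) :
    ‖starPow p n q‖ ≤ 2 * r ^ n := by
  have hform : starPow p n q = c * (z - p) ^ n + d * (w - p) ^ n := by
    induction n with
    | zero => simp [starPow_zero, hcd]
    | succ n ih =>
      have h1 : (z - p) ^ n * p = p * (z - p) ^ n := (hz.sub_left (Commute.refl p)).pow_left n
      have h2 : (w - p) ^ n * p = p * (w - p) ^ n := (hw.sub_left (Commute.refl p)).pow_left n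
      rw [starPow_succ, ih, mul_add, add_mul, ← mul_assoc, ← mul_assoc, hc, hd, mul_assoc c _ p, h1,
        mul_assoc d _ p, h2, pow_succ', pow_succ']
      noncomm_ring
  have hbound : ∀ e y : ℍ, ‖e‖ ≤ 1 → ‖y‖ ≤ r → ‖e * y ^ n‖ ≤ r ^ n := by
    intro e y he hy
    rw [norm_mul, norm_pow]
    calc ‖e‖ * ‖y‖ ^ n ≤ 1 * r ^ n := by gcongr
      _ = r ^ n := one_mul _
  rw [hform]
  linarith [norm_add_le (c * (z - p) ^ n) (d * (w - p) ^ n), hbound c _ hcn hzr,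
    hbound d _ hdn hwr]

theorem norm_starPow_le_omegaDist (p q : ℍ) (n : ℕ) :
    ‖starPow p n q‖ ≤ 2 * omegaDist q p ^ n := by
  obtain ⟨I, hI, -, hIn, hq⟩ := exists_imaginary_unit q
  obtain ⟨J, hJ, hJre, hJn, hp⟩ := exists_imaginary_unit p
  set x := q.re
  set y := ‖q.im‖
  set u := p.re
  set v := ‖p.im‖
  have hy0 : 0 ≤ y := norm_nonneg _
  have hv0 : 0 ≤ v := norm_nonneg _
  have hcomm : ∀ t : ℝ, Commute ((x : ℍ) + t • J) p := by
    intro t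
    have h : Commute ((x : ℍ) + t • J) J :=
      (Quaternion.coe_commute x J).add_left ((Commute.refl J).smul_left t)
    rw [hp]
    exact (Quaternion.coe_commute u _).symm.add_right (h.smul_right v)
  have hdist : ∀ t : ℝ, ‖(x : ℍ) + t • J - p‖ = √((x - u) ^ 2 + (t - v) ^ 2) := by
    intro t
    rw [← norm_coe_add_smul_of_unit hJre hJn, hp]
    congr 1
    push_cast
    module
  have hIJ : ‖I * J‖ = 1 := by rw [norm_mul, hIn, hJn, one_mul]
  have hIIJ : I * (I * J) = -J := by rw [← mul_assoc, hI, neg_one_mul]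
  have hIJJ : I * J * J = -I := by rw [mul_assoc, hJ, mul_neg_one]
  have hxc : (x : ℍ) * (I * J) = I * J * (x : ℍ) := Quaternion.coe_commutes x _
  have hhalf : ∀ e : ℍ, ‖e‖ ≤ 2 → ‖(2⁻¹ : ℝ) • e‖ ≤ 1 := by
    intro e he
    rw [norm_smul]
    norm_num
    linarith
  refine norm_starPow_le_of_semiconj (c := (2⁻¹ : ℝ) • (1 - I * J)) (d := (2⁻¹ : ℝ) • (1 + I * J))
    (z := (x : ℍ) + y • J) (w := (x : ℍ) + (-y) • J) ?_ ?_ ?_ (hcomm y) (hcomm (-y)) ?_ ?_ ?_ ?_ n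
  · module
  · rw [hq, mul_smul_comm, smul_mul_assoc, mul_sub, sub_mul]
    simp only [add_mul, mul_add, smul_mul_assoc, mul_smul_comm, hIIJ, hIJJ, hxc, mul_one, one_mul]
    module
  · rw [hq, mul_smul_comm, smul_mul_assoc, mul_add]
    simp only [add_mul, mul_add, smul_mul_assoc, mul_smul_comm, hIIJ, hIJJ, hxc, mul_one, one_mul]
    module
  · refine hhalf _ ((norm_sub_le _ _).trans ?_)
    rw [hIJ, norm_one]
    norm_num
  · refine hhalf _ ((norm_add_le _ _).trans ?_)
    rw [hIJ, norm_one]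
    norm_num
  · rw [hdist, omegaDist]
    exact Real.sqrt_le_sqrt (by nlinarith [mul_nonneg hy0 hv0])
  · rw [hdist, omegaDist]
    exact Real.sqrt_le_sqrt (by nlinarith [mul_nonneg hy0 hv0])

theorem sigmaDist_nonneg (q p : ℍ) : 0 ≤ sigmaDist q p := by
  unfold sigmaDist
  split_ifs
  · exact norm_nonneg _
  · exact Real.sqrt_nonneg _

theorem norm_starPow_le_sigmaDist (p q : ℍ) (n : ℕ) :
    ‖starPow p n q‖ ≤ 2 * sigmaDist q p ^ n := by
  unfold sigmaDist
  split_ifs with h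
  · rw [starPow_of_commute h.commute, norm_pow]
    linarith [pow_nonneg (norm_nonneg (q - p)) n]
  · exact norm_starPow_le_omegaDist p q n

theorem summable_norm_mul_pow_of_limsup_eq {E : Type*} [SeminormedAddGroup E] {a : ℕ → E} {R r : ℝ}
    (hR : 0 < R) (hlim : Filter.limsup (fun n : ℕ => ‖a n‖ ^ (1 / (n : ℝ))) Filter.atTop = 1 / R)
    (hr0 : 0 ≤ r) (hr : r < R) : Summable fun n => ‖a n‖ * r ^ n := by
  obtain ⟨s, hrs, hsR⟩ := exists_between hr
  have hs : 0 < s := hr0.trans_lt hrs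
  have hbdd : Filter.IsBoundedUnder (· ≤ ·) Filter.atTop fun n : ℕ => ‖a n‖ ^ (1 / (n : ℝ)) := by
    by_contra hb
    have hempty : {c : ℝ | ∀ᶠ n : ℕ in Filter.atTop, ‖a n‖ ^ (1 / (n : ℝ)) ≤ c} = ∅ :=
      Set.eq_empty_iff_forall_notMem.mpr fun c hc => hb ⟨c, by simpa using hc⟩
    rw [Filter.limsup_eq, hempty, Real.sInf_empty] at hlim
    exact (one_div_pos.mpr hR).ne hlim
  have hlt := Filter.eventually_lt_of_limsup_lt
    (hlim.trans_lt (one_div_lt_one_div_of_lt hs hsR)) hbdd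
  refine Summable.of_norm_bounded_eventually_nat (g := fun n => (r / s) ^ n)
    (summable_geometric_of_lt_one (by positivity) ((div_lt_one hs).mpr hrs)) ?_
  filter_upwards [hlt, Filter.eventually_gt_atTop 0] with n hn hn0
  have hroot : ‖a n‖ ≤ (1 / s) ^ n := by
    rw [one_div (n : ℝ)] at hn
    calc ‖a n‖ = (‖a n‖ ^ ((n : ℝ)⁻¹)) ^ n :=
          (Real.rpow_inv_natCast_pow (norm_nonneg _) hn0.ne').symm
      _ ≤ (1 / s) ^ n := by gcongr
  rw [Real.norm_of_nonneg (by positivity)]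
  calc ‖a n‖ * r ^ n ≤ (1 / s) ^ n * r ^ n := by gcongr
    _ = (r / s) ^ n := by rw [← mul_pow]; ring

/-- Rearrangement of a double series along antidiagonals. -/
theorem tsum_antidiagonal_eq_tsum_tsum {E : Type*} [NormedAddCommGroup E] [CompleteSpace E]
    {F : ℕ × ℕ → E} {g : ℕ → ℝ} (hg : Summable g)
    (hF : ∀ k, ∑ x ∈ Finset.HasAntidiagonal.antidiagonal k, ‖F x‖ ≤ g k) :
    ∑' k, ∑ x ∈ Finset.HasAntidiagonal.antidiagonal k, F x = ∑' n, ∑' m, F (n, m) := by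
  let e := Finset.HasAntidiagonal.sigmaAntidiagonalEquivProd (A := ℕ)
  have hfin : ∀ k, ∑' x : Finset.HasAntidiagonal.antidiagonal k, ‖F x‖ =
      ∑ x ∈ Finset.HasAntidiagonal.antidiagonal k, ‖F x‖ :=
    fun k => Finset.tsum_subtype (Finset.HasAntidiagonal.antidiagonal k) fun x => ‖F x‖
  have hnorm : Summable fun x : (Σ k : ℕ, Finset.HasAntidiagonal.antidiagonal k) => ‖F (e x)‖ := by
    refine (summable_sigma_of_nonneg fun _ => norm_nonneg _).mpr
      ⟨fun k => (hasSum_fintype _).summable, ?_⟩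
    refine Summable.of_nonneg_of_le (fun k => tsum_nonneg fun _ => norm_nonneg _) (fun k => ?_) hg
    exact (hfin k).trans_le (hF k)
  have hsum : Summable fun x => F (e x) := hnorm.of_norm
  have hprod : Summable F := e.summable_iff.mp hsum
  rw [← hprod.tsum_prod, ← e.tsum_eq F, hsum.tsum_sigma]
  exact tsum_congr fun k => (Finset.tsum_subtype (Finset.HasAntidiagonal.antidiagonal k) F).symm

theorem expansion_theorem (a : ℕ → ℍ) (R : ℝ) (hR : 0 < R)
    (hlim : Filter.limsup (fun n : ℕ => ‖a n‖ ^ (1/(n:ℝ))) Filter.atTop = 1/R)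
    (p : ℍ) (hp : ‖p‖ < R) (q : ℍ) (hq : sigmaDist q p < R - ‖p‖) :
    ∑' n : ℕ, q^n * a n =
      ∑' n : ℕ, starPow p n q *
        ((∑' m : ℕ, p^m * (a (m+n) * (((m+n).factorial / m.factorial : ℕ) : ℍ)))
          / ((n.factorial : ℕ) : ℍ)) := by
  set s := sigmaDist q p
  have hs0 : 0 ≤ s := sigmaDist_nonneg q p
  let F : ℕ × ℕ → ℍ := fun x =>
    starPow p x.1 q * (((x.1 + x.2).choose x.1 • p ^ x.2) * a (x.1 + x.2))
  have hmajorant : Summable fun k => 2 * (‖a k‖ * (s + ‖p‖) ^ k) :=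
    (summable_norm_mul_pow_of_limsup_eq hR hlim (by positivity) (by linarith)).mul_left 2
  have hF : ∀ k, ∑ x ∈ Finset.HasAntidiagonal.antidiagonal k, ‖F x‖ ≤
      2 * (‖a k‖ * (s + ‖p‖) ^ k) := by
    intro k
    rw [(Commute.all s ‖p‖).add_pow', Finset.mul_sum, Finset.mul_sum]
    refine Finset.sum_le_sum fun x hx => ?_
    have hx' := Finset.HasAntidiagonal.mem_antidiagonal.mp hx
    simp only [F, hx', norm_mul, nsmul_eq_mul, norm_pow, quaternion_norm_natCast]
    calc ‖starPow p x.1 q‖ * (k.choose x.1 * ‖p‖ ^ x.2 * ‖a k‖)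
        ≤ 2 * s ^ x.1 * (k.choose x.1 * ‖p‖ ^ x.2 * ‖a k‖) := by
          gcongr
          exact norm_starPow_le_sigmaDist p q x.1
      _ = 2 * (‖a k‖ * (k.choose x.1 * (s ^ x.1 * ‖p‖ ^ x.2))) := by ring
  have hleft : ∀ k, q ^ k * a k = ∑ x ∈ Finset.HasAntidiagonal.antidiagonal k, F x := by
    intro k
    rw [pow_eq_sum_starPow p q k, Finset.sum_mul]
    refine Finset.sum_congr rfl fun x hx => ?_
    simp only [F, Finset.HasAntidiagonal.mem_antidiagonal.mp hx, mul_assoc]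
  rw [tsum_congr hleft, tsum_antidiagonal_eq_tsum_tsum hmajorant hF]
  refine tsum_congr fun n => ?_
  rw [← tsum_div_const, ← tsum_mul_left]
  refine tsum_congr fun m => ?_
  have hfact : (m + n).factorial / m.factorial = (n + m).choose n * n.factorial := by
    refine Nat.div_eq_of_eq_mul_left m.factorial_pos ?_
    rw [add_comm m n, ← Nat.choose_mul_factorial_mul_factorial (Nat.le_add_right n m),
      Nat.add_sub_cancel_left]
  have hn : ((n.factorial : ℕ) : ℍ) ≠ 0 := by
    rw [← norm_ne_zero_iff, quaternion_norm_natCast]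
    exact_mod_cast n.factorial_ne_zero
  have hchoose := Nat.cast_commute ((n + m).choose n) (p ^ m * a (n + m))
  simp only [F]
  rw [hfact, add_comm m n, Nat.cast_mul, ← mul_assoc (p ^ m), ← mul_assoc (p ^ m * a (n + m)),
    mul_div_cancel_right₀ _ hn, ← hchoose.eq, smul_mul_assoc, nsmul_eq_mul]
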